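/- For every β < 0, the functional J_{λ₁(V),β}(u) = (1/2)∫_V (|∇u|² − λ₁(V) u²) dμ − β log ∫_V h e^u dμ attains its infimum over E₁^⊥ at some u ∈ E₁^⊥, and this minimizer u satisfies the equation Δu + λ₁(V)u = −β h e^u / (∫_V h e^u dμ) + β / Vol(V) + Σ_{i=1}^{n₁} (β ∫_V h u_{1i} e^u dμ / ∫_V h e^u dμ) · u_{1i} on V. -/

import Mathlib

open Finset

variable {V : Type*}

/-- Integral of `g` over `V` with respect to the measure `μ`. -/
noncomputable def intV [Fintype V] (μ g : V → ℝ) : ℝ := ∑ x, μ x * g x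

/-- Volume of `V` with respect to the measure `μ`. -/
noncomputable def volV [Fintype V] (μ : V → ℝ) : ℝ := ∑ x, μ x

/-- The space `H` of functions with zero mean. -/
def Hsp [Fintype V] (μ : V → ℝ) : Set (V → ℝ) := {u | intV μ u = 0}

/-- `|∇u|²(x)`, the squared length of the gradient of `u` at `x`. -/
noncomputable def gradSq [Fintype V] (G : SimpleGraph V) [DecidableRel G.Adj]
    (w : V → V → ℝ) (μ : V → ℝ) (u : V → ℝ) (x : V) : ℝ :=
  (1 / (2 * μ x)) * ∑ y, if G.Adj x y then w x y * (u y - u x) ^ 2 else 0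

/-- The `μ`-Laplacian `Δu(x)`. -/
noncomputable def lapV [Fintype V] (G : SimpleGraph V) [DecidableRel G.Adj]
    (w : V → V → ℝ) (μ : V → ℝ) (u : V → ℝ) (x : V) : ℝ :=
  (1 / μ x) * ∑ y, if G.Adj x y then w x y * (u y - u x) else 0

/-- The functional `J_β`. -/
noncomputable def Jb [Fintype V] (G : SimpleGraph V) [DecidableRel G.Adj]
    (w : V → V → ℝ) (μ h : V → ℝ) (β : ℝ) (u : V → ℝ) : ℝ :=
  (1 / 2) * intV μ (gradSq G w μ u)
    - β * Real.log (intV μ (fun x => h x * Real.exp (u x)))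

/-- The functional `J_{α,β}`. -/
noncomputable def Jab [Fintype V] (G : SimpleGraph V) [DecidableRel G.Adj]
    (w : V → V → ℝ) (μ h : V → ℝ) (α β : ℝ) (u : V → ℝ) : ℝ :=
  (1 / 2) * intV μ (fun x => gradSq G w μ u x - α * u x ^ 2)
    - β * Real.log (intV μ (fun x => h x * Real.exp (u x)))

/-- The first non-zero eigenvalue `λ₁(V)` of `-Δ`, defined variationally. -/
noncomputable def lam1V [Fintype V] (G : SimpleGraph V) [DecidableRel G.Adj]
    (w : V → V → ℝ) (μ : V → ℝ) : ℝ :=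
  sInf ((fun u => intV μ (gradSq G w μ u)) ''
    {u | u ∈ Hsp μ ∧ intV μ (fun x => u x ^ 2) = 1})

/-- The eigenspace of `-Δ` with eigenvalue `c` (inside `H`). -/
def eigSp [Fintype V] (G : SimpleGraph V) [DecidableRel G.Adj]
    (w : V → V → ℝ) (μ : V → ℝ) (c : ℝ) : Set (V → ℝ) :=
  {v | intV μ v = 0 ∧ ∀ x, -(lapV G w μ v x) = c * v x}

/-- `E_k^⊥`: functions in `H` orthogonal to the eigenspaces of the first `k`
distinct non-zero eigenvalues (`lam` lists the distinct non-zero eigenvalues,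
0-indexed, so `lam ⟨s⟩` is `λ_{s+1}(V)`). -/
def EkPerp [Fintype V] (G : SimpleGraph V) [DecidableRel G.Adj]
    (w : V → V → ℝ) (μ : V → ℝ) {m : ℕ} (lam : Fin m → ℝ) (k : ℕ) : Set (V → ℝ) :=
  {u | u ∈ Hsp μ ∧ ∀ s : Fin m, (s : ℕ) < k → ∀ v ∈ eigSp G w μ (lam s),
    intV μ (fun x => u x * v x) = 0}

section Quadratic

variable [Fintype V] (G : SimpleGraph V) [DecidableRel G.Adj] (w : V → V → ℝ) (μ : V → ℝ)

/-- The Dirichlet form `∫ ∇u · ∇v dμ`. -/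
noncomputable def dirichletForm (u v : V → ℝ) : ℝ :=
  (1 / 2) * ∑ x, ∑ y, if G.Adj x y then w x y * ((u y - u x) * (v y - v x)) else 0

/-- The form `∫ (∇u · ∇v - a u v) dμ`. -/
noncomputable def shiftedForm (a : ℝ) (u v : V → ℝ) : ℝ :=
  dirichletForm G w u v - a * intV μ (fun x => u x * v x)

/-- The functions of zero mean that are orthogonal to the eigenspace of `a`. -/
def eigPerp (a : ℝ) : Set (V → ℝ) :=
  {u | u ∈ Hsp μ ∧ ∀ v ∈ eigSp G w μ a, intV μ (fun x => u x * v x) = 0}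

lemma intV_add (f g : V → ℝ) : intV μ (fun x => f x + g x) = intV μ f + intV μ g := by
  simp [intV, mul_add, sum_add_distrib]

lemma intV_const_mul (c : ℝ) (f : V → ℝ) : intV μ (fun x => c * f x) = c * intV μ f := by
  simp only [intV, mul_sum]
  exact sum_congr rfl fun x _ => by ring

lemma intV_sub (f g : V → ℝ) : intV μ (fun x => f x - g x) = intV μ f - intV μ g := by
  simp [intV, mul_sub, sum_sub_distrib]

lemma intV_sum {ι : Type*} (s : Finset ι) (f : ι → V → ℝ) :
    intV μ (fun x => ∑ i ∈ s, f i x) = ∑ i ∈ s, intV μ (f i) := by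
  simp only [intV, mul_sum]
  exact sum_comm

lemma intV_const (c : ℝ) : intV μ (fun _ => c) = c * volV μ := by
  simp only [intV, volV, mul_sum]
  exact sum_congr rfl fun x _ => by ring

variable {μ} in
lemma intV_sq_nonneg (hμ : ∀ x, 0 < μ x) (f : V → ℝ) : 0 ≤ intV μ (fun x => f x ^ 2) :=
  sum_nonneg fun x _ => mul_nonneg (hμ x).le (sq_nonneg _)

variable {μ} in
lemma eq_zero_of_intV_sq_eq_zero (hμ : ∀ x, 0 < μ x) {f : V → ℝ}
    (hf : intV μ (fun x => f x ^ 2) = 0) : f = 0 := by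
  funext x
  have := (sum_eq_zero_iff_of_nonneg
    (fun x _ => mul_nonneg (hμ x).le (sq_nonneg (f x)))).1 hf x (mem_univ x)
  simpa [(hμ x).ne'] using this

lemma dirichletForm_comm (u v : V → ℝ) : dirichletForm G w u v = dirichletForm G w v u := by
  simp only [dirichletForm, mul_comm]

lemma dirichletForm_smul (t : ℝ) (u : V → ℝ) :
    dirichletForm G w (t • u) (t • u) = t ^ 2 * dirichletForm G w u u := by
  simp only [dirichletForm, mul_sum, Pi.smul_apply, smul_eq_mul]
  refine sum_congr rfl fun x _ => sum_congr rfl fun y _ => ?_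
  split_ifs <;> ring

lemma shiftedForm_smul (a t : ℝ) (u : V → ℝ) :
    shiftedForm G w μ a (t • u) (t • u) = t ^ 2 * shiftedForm G w μ a u u := by
  have : intV μ (fun x => (t • u) x * (t • u) x) = t ^ 2 * intV μ (fun x => u x * u x) := by
    rw [← intV_const_mul]
    congr 1; funext x; simp; ring
  rw [shiftedForm, this, dirichletForm_smul, shiftedForm]
  ring

lemma shiftedForm_add_smul (a t : ℝ) (u v : V → ℝ) :
    shiftedForm G w μ a (u + t • v) (u + t • v) = shiftedForm G w μ a u u
      + 2 * t * shiftedForm G w μ a u v + t ^ 2 * shiftedForm G w μ a v v := by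
  simp only [shiftedForm, dirichletForm, intV, mul_sub, mul_sum, Pi.add_apply, Pi.smul_apply,
    smul_eq_mul]
  have key : ∀ A B C D A' B' C' D' : ℝ, A = B + C + D → A' = B' + C' + D' →
      A - A' = B - B' + (C - C') + (D - D') := by
    intros; subst_vars; ring
  apply key
  · simp only [← sum_add_distrib]
    refine sum_congr rfl fun x _ => sum_congr rfl fun y _ => ?_
    split_ifs <;> ring
  · simp only [← sum_add_distrib]
    exact sum_congr rfl fun x _ => by ring

variable {G w μ}

lemma intV_lapV_mul (hws : ∀ x y, w x y = w y x) (hμ : ∀ x, 0 < μ x) (u v : V → ℝ) :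
    intV μ (fun x => lapV G w μ u x * v x) = -dirichletForm G w u v := by
  have h1 : intV μ (fun x => lapV G w μ u x * v x)
      = ∑ x, ∑ y, if G.Adj x y then w x y * (u y - u x) * v x else 0 := by
    refine sum_congr rfl fun x _ => ?_
    have := (hμ x).ne'
    simp only [lapV, sum_mul, mul_sum]
    refine sum_congr rfl fun y _ => ?_
    split_ifs
    · field_simp
    · simp
  have h2 : (∑ x, ∑ y, if G.Adj x y then w x y * (u y - u x) * v x else 0)
      = ∑ x, ∑ y, if G.Adj x y then w x y * (u x - u y) * v y else 0 := by
    rw [sum_comm]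
    refine sum_congr rfl fun x _ => sum_congr rfl fun y _ => ?_
    simp only [G.adj_comm y x, hws y x]
  have h3 : dirichletForm G w u v = -(1 / 2) *
      ((∑ x, ∑ y, if G.Adj x y then w x y * (u y - u x) * v x else 0)
      + ∑ x, ∑ y, if G.Adj x y then w x y * (u x - u y) * v y else 0) := by
    simp only [dirichletForm, ← sum_add_distrib, mul_sum]
    refine sum_congr rfl fun x _ => sum_congr rfl fun y _ => ?_
    split_ifs <;> ring
  rw [h3, ← h2, h1]
  ring

lemma intV_gradSq (hμ : ∀ x, 0 < μ x) (u : V → ℝ) :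
    intV μ (gradSq G w μ u) = dirichletForm G w u u := by
  simp only [intV, dirichletForm, mul_sum]
  refine sum_congr rfl fun x _ => ?_
  have := (hμ x).ne'
  simp only [gradSq, mul_sum]
  refine sum_congr rfl fun y _ => ?_
  split_ifs
  · field_simp
  · simp

lemma dirichletForm_self_nonneg (hwp : ∀ x y, G.Adj x y → 0 < w x y) (u : V → ℝ) :
    0 ≤ dirichletForm G w u u := by
  refine mul_nonneg (by norm_num) (sum_nonneg fun x _ => sum_nonneg fun y _ => ?_)
  split_ifs with h
  · exact mul_nonneg (hwp x y h).le (mul_self_nonneg _)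
  · rfl

lemma intV_lapV_add_mul (hws : ∀ x y, w x y = w y x) (hμ : ∀ x, 0 < μ x) (a : ℝ)
    (u v : V → ℝ) :
    intV μ (fun x => (lapV G w μ u x + a * u x) * v x) = -shiftedForm G w μ a u v := by
  simp only [add_mul, mul_assoc]
  rw [intV_add, intV_lapV_mul hws hμ, intV_const_mul, shiftedForm]
  ring

lemma intV_lapV (hws : ∀ x y, w x y = w y x) (hμ : ∀ x, 0 < μ x) (u : V → ℝ) :
    intV μ (lapV G w μ u) = 0 := by
  have := intV_lapV_mul (G := G) hws hμ u 1
  simpa [dirichletForm] using this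

lemma shiftedForm_eq_zero_of_mem_eigSp (hws : ∀ x y, w x y = w y x) (hμ : ∀ x, 0 < μ x)
    {a : ℝ} {v : V → ℝ} (hv : v ∈ eigSp G w μ a) (u : V → ℝ) :
    shiftedForm G w μ a u v = 0 := by
  have h1 : shiftedForm G w μ a u v = shiftedForm G w μ a v u := by
    simp only [shiftedForm, dirichletForm_comm G w u v, mul_comm (u _)]
  have h2 := intV_lapV_add_mul (G := G) hws hμ a v u
  have h3 : (fun x => (lapV G w μ v x + a * v x) * u x) = fun _ => 0 := by
    funext x
    rw [← hv.2 x]; ring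
  rw [h3, intV_const] at h2
  linarith

lemma shiftedForm_lam1V_nonneg (hwp : ∀ x y, G.Adj x y → 0 < w x y) (hμ : ∀ x, 0 < μ x)
    {u : V → ℝ} (hu : u ∈ Hsp μ) : 0 ≤ shiftedForm G w μ (lam1V G w μ) u u := by
  by_cases h0 : intV μ (fun x => u x ^ 2) = 0
  · rw [eq_zero_of_intV_sq_eq_zero hμ h0]
    simp [shiftedForm, dirichletForm, intV]
  have hs : 0 < intV μ (fun x => u x ^ 2) := lt_of_le_of_ne (intV_sq_nonneg hμ u) (Ne.symm h0)
  set s := intV μ (fun x => u x ^ 2) with hsdef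
  set t := (Real.sqrt s)⁻¹ with ht
  have ht2 : t ^ 2 = s⁻¹ := by rw [ht, inv_pow, Real.sq_sqrt hs.le]
  have hmem : t • u ∈ {u | u ∈ Hsp μ ∧ intV μ (fun x => u x ^ 2) = 1} := by
    constructor
    · change intV μ (fun x => t * u x) = 0
      rw [intV_const_mul, show intV μ u = 0 from hu, mul_zero]
    · simp only [Pi.smul_apply, smul_eq_mul, mul_pow]
      rw [intV_const_mul, ht2, ← hsdef, inv_mul_cancel₀ h0]
  have hle : lam1V G w μ ≤ intV μ (gradSq G w μ (t • u)) := by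
    refine csInf_le ⟨0, ?_⟩ ⟨_, hmem, rfl⟩
    rintro _ ⟨v, -, rfl⟩
    simpa only [intV_gradSq hμ] using dirichletForm_self_nonneg hwp v
  rw [intV_gradSq hμ, dirichletForm_smul, ht2, inv_mul_eq_div, le_div_iff₀ hs] at hle
  simp only [shiftedForm, ← sq]
  linarith

lemma add_smul_mem_Hsp {u v : V → ℝ} (hu : u ∈ Hsp μ) (hv : v ∈ Hsp μ) (t : ℝ) :
    u + t • v ∈ Hsp μ := by
  change intV μ (fun x => u x + t * v x) = 0
  rw [intV_add, intV_const_mul, show intV μ u = 0 from hu, show intV μ v = 0 from hv]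
  ring

lemma add_smul_mem_eigPerp {a : ℝ} {u v : V → ℝ} (hu : u ∈ eigPerp G w μ a)
    (hv : v ∈ eigPerp G w μ a) (t : ℝ) : u + t • v ∈ eigPerp G w μ a := by
  refine ⟨add_smul_mem_Hsp hu.1 hv.1 t, fun z hz => ?_⟩
  simp only [Pi.add_apply, Pi.smul_apply, smul_eq_mul, add_mul, mul_assoc]
  rw [intV_add, intV_const_mul, hu.2 z hz, hv.2 z hz]
  ring

lemma zero_mem_eigPerp (a : ℝ) : (0 : V → ℝ) ∈ eigPerp G w μ a := by
  constructor
  · change intV μ 0 = 0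
    simp [intV]
  · simp [intV]

/-- A zero-mean function attaining the infimum of the Rayleigh quotient is an eigenfunction. -/
lemma mem_eigSp_of_shiftedForm_eq_zero (hws : ∀ x y, w x y = w y x)
    (hwp : ∀ x y, G.Adj x y → 0 < w x y) (hμ : ∀ x, 0 < μ x)
    {u : V → ℝ} (hu : u ∈ Hsp μ) (h0 : shiftedForm G w μ (lam1V G w μ) u u = 0) :
    u ∈ eigSp G w μ (lam1V G w μ) := by
  set a := lam1V G w μ
  have hB : ∀ v ∈ Hsp μ, shiftedForm G w μ a u v = 0 := by
    intro v hv
    have hd := discrim_le_zero (a := shiftedForm G w μ a v v)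
      (b := 2 * shiftedForm G w μ a u v) (c := 0) fun t => by
        have := shiftedForm_lam1V_nonneg hwp hμ (add_smul_mem_Hsp hu hv t)
        rw [shiftedForm_add_smul, h0] at this
        linarith
    rw [discrim] at hd
    nlinarith [sq_nonneg (shiftedForm G w μ a u v)]
  have hf : (fun x => lapV G w μ u x + a * u x) ∈ Hsp μ := by
    change intV μ _ = 0
    rw [intV_add, intV_const_mul, show intV μ u = 0 from hu, mul_zero, add_zero]
    exact intV_lapV hws hμ u
  have hz := eq_zero_of_intV_sq_eq_zero hμ (f := fun x => lapV G w μ u x + a * u x) (by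
    simp only [sq]
    rw [intV_lapV_add_mul hws hμ a u, hB _ hf, neg_zero])
  refine ⟨hu, fun x => ?_⟩
  have := congrFun hz x
  simp only [Pi.zero_apply] at this
  linarith

lemma shiftedForm_pos (hws : ∀ x y, w x y = w y x)
    (hwp : ∀ x y, G.Adj x y → 0 < w x y) (hμ : ∀ x, 0 < μ x)
    {u : V → ℝ} (hu : u ∈ eigPerp G w μ (lam1V G w μ)) (hne : u ≠ 0) :
    0 < shiftedForm G w μ (lam1V G w μ) u u := by
  refine lt_of_le_of_ne (shiftedForm_lam1V_nonneg hwp hμ hu.1) fun h0 => hne ?_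
  have := hu.2 u (mem_eigSp_of_shiftedForm_eq_zero hws hwp hμ hu.1 h0.symm)
  exact eq_zero_of_intV_sq_eq_zero hμ (by simpa only [sq] using this)

lemma continuous_intV_mul (v : V → ℝ) :
    Continuous fun u : V → ℝ => intV μ (fun x => u x * v x) := by
  unfold intV; fun_prop

lemma continuous_dirichletForm : Continuous fun u : V → ℝ => dirichletForm G w u u := by
  unfold dirichletForm
  refine continuous_const.mul
    (continuous_finsetSum _ fun x _ => continuous_finsetSum _ fun y _ => ?_)
  split_ifs <;> fun_prop

lemma continuous_shiftedForm (a : ℝ) : Continuous fun u : V → ℝ => shiftedForm G w μ a u u := by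
  refine continuous_dirichletForm.sub (continuous_const.mul ?_)
  unfold intV; fun_prop

lemma isClosed_eigPerp (a : ℝ) : IsClosed (eigPerp G w μ a) := by
  have heq : eigPerp G w μ a = {u | intV μ u = 0} ∩
      ⋂ v ∈ eigSp G w μ a, {u | intV μ (fun x => u x * v x) = 0} := by
    ext u
    simp [eigPerp, Hsp]
  rw [heq]
  refine IsClosed.inter (isClosed_eq ?_ continuous_const) (isClosed_biInter fun v _ =>
    isClosed_eq (continuous_intV_mul v) continuous_const)
  unfold intV; fun_prop

lemma exists_pos_mul_norm_sq_le_shiftedForm (hws : ∀ x y, w x y = w y x)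
    (hwp : ∀ x y, G.Adj x y → 0 < w x y) (hμ : ∀ x, 0 < μ x) :
    ∃ c > 0, ∀ u ∈ eigPerp G w μ (lam1V G w μ),
      c * ‖u‖ ^ 2 ≤ shiftedForm G w μ (lam1V G w μ) u u := by
  set a := lam1V G w μ
  have hK : IsCompact (eigPerp G w μ a ∩ Metric.sphere 0 1) :=
    (isCompact_sphere 0 1).inter_left (isClosed_eigPerp a)
  obtain ⟨c, hc, hle⟩ : ∃ c > 0, ∀ u ∈ eigPerp G w μ a ∩ Metric.sphere 0 1,
      c ≤ shiftedForm G w μ a u u := by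
    refine hK.exists_forall_le' (continuous_shiftedForm a).continuousOn fun u hu => ?_
    refine shiftedForm_pos hws hwp hμ hu.1 ?_
    rintro rfl
    simpa using hu.2
  refine ⟨c, hc, fun u hu => ?_⟩
  rcases eq_or_ne u 0 with rfl | hne
  · simp [shiftedForm, dirichletForm, intV]
  have hn : 0 < ‖u‖ := norm_pos_iff.2 hne
  have h1 := hle (‖u‖⁻¹ • u) ⟨by
    simpa using add_smul_mem_eigPerp (zero_mem_eigPerp a) hu ‖u‖⁻¹, by
    simp [norm_smul, hn.ne']⟩
  rw [shiftedForm_smul, inv_pow, inv_mul_eq_div, le_div_iff₀ (by positivity)] at h1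
  exact h1

lemma intV_mul_exp_pos [Nonempty V] {h : V → ℝ} (hμ : ∀ x, 0 < μ x) (hh : ∀ x, 0 < h x)
    (u : V → ℝ) : 0 < intV μ (fun x => h x * Real.exp (u x)) :=
  sum_pos (fun x _ => mul_pos (hμ x) (mul_pos (hh x) (Real.exp_pos _))) univ_nonempty

lemma exists_pos_le_intV_mul_exp [Nonempty V] {h : V → ℝ} (hμ : ∀ x, 0 < μ x)
    (hh : ∀ x, 0 < h x) :
    ∃ m > 0, ∀ u ∈ Hsp μ, m ≤ intV μ (fun x => h x * Real.exp (u x)) := by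
  obtain ⟨z, hz⟩ := Finite.exists_min fun x => μ x * h x
  refine ⟨μ z * h z, mul_pos (hμ z) (hh z), fun u hu => ?_⟩
  obtain ⟨x, hx⟩ : ∃ x, 0 ≤ u x := by
    by_contra! hneg
    have : intV μ u < 0 := sum_neg (fun x _ => mul_neg_of_pos_of_neg (hμ x) (hneg x)) univ_nonempty
    exact this.ne hu
  calc μ z * h z ≤ μ x * h x := hz x
    _ ≤ μ x * (h x * Real.exp (u x)) := by
      have := mul_pos (hμ x) (hh x)
      rw [← mul_assoc]
      exact le_mul_of_one_le_right this.le (Real.one_le_exp hx)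
    _ ≤ _ := single_le_sum (f := fun x => μ x * (h x * Real.exp (u x)))
      (fun x _ => (mul_pos (hμ x) (mul_pos (hh x) (Real.exp_pos _))).le) (mem_univ x)

lemma Jab_eq (hμ : ∀ x, 0 < μ x) (h : V → ℝ) (a β : ℝ) (u : V → ℝ) :
    Jab G w μ h a β u = (1 / 2) * shiftedForm G w μ a u u
      - β * Real.log (intV μ (fun x => h x * Real.exp (u x))) := by
  simp only [Jab, intV_sub, intV_const_mul, intV_gradSq hμ, shiftedForm, sq]

lemma exists_isMinOn_Jab [Nonempty V] (hws : ∀ x y, w x y = w y x)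
    (hwp : ∀ x y, G.Adj x y → 0 < w x y) (hμ : ∀ x, 0 < μ x) {h : V → ℝ}
    (hh : ∀ x, 0 < h x) {β : ℝ} (hβ : β < 0) :
    ∃ u ∈ eigPerp G w μ (lam1V G w μ),
      IsMinOn (Jab G w μ h (lam1V G w μ) β) (eigPerp G w μ (lam1V G w μ)) u := by
  set a := lam1V G w μ
  have hcont : Continuous (Jab G w μ h a β) := by
    rw [funext (Jab_eq hμ h a β)]
    refine (continuous_const.mul (continuous_shiftedForm a)).sub
      (continuous_const.mul (Continuous.log ?_ fun u => (intV_mul_exp_pos hμ hh u).ne'))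
    unfold intV; fun_prop
  obtain ⟨c, hc, hcq⟩ := exists_pos_mul_norm_sq_le_shiftedForm (G := G) hws hwp hμ
  obtain ⟨m, hm, hmle⟩ := exists_pos_le_intV_mul_exp hμ hh
  have hlow : ∀ u ∈ eigPerp G w μ a, c / 2 * ‖u‖ ^ 2 - β * Real.log m ≤ Jab G w μ h a β u := by
    intro u hu
    rw [Jab_eq hμ]
    have h1 := hcq u hu
    have h2 := mul_le_mul_of_nonpos_left (Real.log_le_log hm (hmle u hu.1)) hβ.le
    linarith
  refine hcont.continuousOn.exists_isMinOn' (isClosed_eigPerp a) (zero_mem_eigPerp a) ?_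
  have hinf : Filter.Tendsto (fun u : V → ℝ => c / 2 * ‖u‖ ^ 2 - β * Real.log m)
      (Filter.cocompact _) Filter.atTop :=
    Filter.tendsto_atTop_add_const_right _ _
      (((Filter.tendsto_pow_atTop two_ne_zero).comp
        (tendsto_norm_cocompact_atTop)).const_mul_atTop (half_pos hc))
  rw [Filter.eventually_inf_principal]
  filter_upwards [hinf.eventually_ge_atTop (Jab G w μ h a β 0)] with u hu hmem
  exact hu.trans (hlow u hmem)

/-- The first variation of the functional vanishes at a minimizer. -/
lemma shiftedForm_eq_of_isMinOn [Nonempty V] (hμ : ∀ x, 0 < μ x) {h : V → ℝ}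
    (hh : ∀ x, 0 < h x) {a β : ℝ} {u v : V → ℝ} (hu : u ∈ eigPerp G w μ a)
    (hmin : IsMinOn (Jab G w μ h a β) (eigPerp G w μ a) u) (hv : v ∈ eigPerp G w μ a) :
    shiftedForm G w μ a u v = β * (intV μ (fun x => h x * Real.exp (u x) * v x)
      / intV μ (fun x => h x * Real.exp (u x))) := by
  have hI := intV_mul_exp_pos hμ hh u
  have hexp : HasDerivAt (fun t : ℝ => intV μ (fun x => h x * Real.exp (u x + t * v x)))
      (intV μ (fun x => h x * Real.exp (u x) * v x)) 0 := by
    unfold intV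
    refine HasDerivAt.fun_sum fun x _ => ?_
    have h1 : HasDerivAt (fun t : ℝ => u x + t * v x) (v x) 0 := by
      simpa using ((hasDerivAt_id (0 : ℝ)).mul_const (v x)).const_add (u x)
    have := (h1.exp.const_mul (h x)).const_mul (μ x)
    simpa [mul_assoc] using this
  have hlog := hexp.log (by simpa using hI.ne')
  have hpoly : HasDerivAt (fun t : ℝ => shiftedForm G w μ a u u
      + 2 * t * shiftedForm G w μ a u v + t ^ 2 * shiftedForm G w μ a v v)
      (2 * shiftedForm G w μ a u v) 0 := by
    have h1 := ((hasDerivAt_id (0 : ℝ)).const_mul 2).mul_const (shiftedForm G w μ a u v)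
    have h2 := (hasDerivAt_pow 2 (0 : ℝ)).mul_const (shiftedForm G w μ a v v)
    simpa using (h1.const_add (shiftedForm G w μ a u u)).fun_add h2
  have hJ := (hpoly.const_mul (1 / 2)).sub (hlog.const_mul β)
  have hloc : IsLocalMin (fun t : ℝ => Jab G w μ h a β (u + t • v)) 0 :=
    Filter.Eventually.of_forall fun t => by
      simpa using hmin (add_smul_mem_eigPerp hu hv t)
  have h0 := hloc.hasDerivAt_eq_zero (hJ.congr_of_eventuallyEq (Filter.Eventually.of_forall
    fun t => by simp [Jab_eq hμ, shiftedForm_add_smul]))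
  simp only [zero_mul, add_zero] at h0
  linarith

lemma intV_mul_eq_zero_of_mem_span {ι : Type*} {U : ι → V → ℝ} {f v : V → ℝ}
    (hf : ∀ i, intV μ (fun x => f x * U i x) = 0)
    (hv : v ∈ Submodule.span ℝ (Set.range U)) : intV μ (fun x => f x * v x) = 0 := by
  induction hv using Submodule.span_induction with
  | mem _ hx => obtain ⟨i, rfl⟩ := hx; exact hf i
  | zero => simp [intV]
  | add x y _ _ hx hy => simp only [Pi.add_apply, mul_add]; rw [intV_add, hx, hy, add_zero]
  | smul t x _ hx =>
    simp only [Pi.smul_apply, smul_eq_mul, mul_left_comm _ t]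
    rw [intV_const_mul, hx, mul_zero]

lemma volV_pos [Nonempty V] (hμ : ∀ x, 0 < μ x) : 0 < volV μ :=
  sum_pos (fun x _ => hμ x) univ_nonempty

end Quadratic

theorem stmt4 [Fintype V] [Nontrivial V] (G : SimpleGraph V) [DecidableRel G.Adj]
    (hG : G.Connected) (w : V → V → ℝ) (hws : ∀ x y, w x y = w y x)
    (hwp : ∀ x y, G.Adj x y → 0 < w x y)
    (μ : V → ℝ) (hμ : ∀ x, 0 < μ x) (h : V → ℝ) (hh : ∀ x, 0 < h x) (β : ℝ) (hβ : β < 0)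
    (n₁ : ℕ) (U : Fin n₁ → V → ℝ)
    (hUeig : ∀ i, U i ∈ eigSp G w μ (lam1V G w μ))
    (hUon : ∀ i j, intV μ (fun x => U i x * U j x) = if i = j then 1 else 0)
    (hUspan : ∀ v ∈ eigSp G w μ (lam1V G w μ), v ∈ Submodule.span ℝ (Set.range U)) :
    ∃ u ∈ {u | u ∈ Hsp μ ∧ ∀ v ∈ eigSp G w μ (lam1V G w μ),
        intV μ (fun x => u x * v x) = 0},
      (∀ v ∈ {u | u ∈ Hsp μ ∧ ∀ v ∈ eigSp G w μ (lam1V G w μ),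
          intV μ (fun x => u x * v x) = 0},
        Jab G w μ h (lam1V G w μ) β u ≤ Jab G w μ h (lam1V G w μ) β v) ∧
      ∀ x, lapV G w μ u x + lam1V G w μ * u x =
        -(β * h x * Real.exp (u x)) / intV μ (fun y => h y * Real.exp (u y))
          + β / volV μ
          + ∑ i, (β * intV μ (fun y => h y * U i y * Real.exp (u y))
              / intV μ (fun y => h y * Real.exp (u y))) * U i x := by
  obtain ⟨u, hu, hmin⟩ := exists_isMinOn_Jab (G := G) hws hwp hμ hh hβ
  refine ⟨u, hu, fun v hv => hmin hv, ?_⟩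
  set a := lam1V G w μ
  set I := intV μ (fun y => h y * Real.exp (u y)) with hI
  have hIpos : 0 < I := intV_mul_exp_pos hμ hh u
  set k : Fin n₁ → ℝ := fun i => β * intV μ (fun y => h y * U i y * Real.exp (u y)) / I with hk
  set f : V → ℝ := fun x => (lapV G w μ u x + a * u x) + ((β / I) * (h x * Real.exp (u x))
    - (β / volV μ + ∑ i, k i * U i x)) with hf
  have hmul : ∀ v : V → ℝ, intV μ (fun x => f x * v x) = -shiftedForm G w μ a u v
      + (β / I * intV μ (fun x => h x * Real.exp (u x) * v x)
        - (β / volV μ * intV μ v + ∑ i, k i * intV μ (fun x => U i x * v x))) := by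
    intro v
    rw [← intV_lapV_add_mul hws hμ]
    simp only [← intV_const_mul, ← intV_sum, ← intV_sub, ← intV_add]
    congr 1; funext x
    rw [hf]
    simp only [add_mul, sub_mul, sum_mul, mul_assoc]
  have hfH : f ∈ Hsp μ := by
    have h1 := hmul 1
    have h2 : shiftedForm G w μ a u 1 = 0 := by
      simp [shiftedForm, dirichletForm, show intV μ u = 0 from hu.1]
    have h3 : ∀ i, intV μ (U i) = 0 := fun i => (hUeig i).1
    have h4 : intV μ (1 : V → ℝ) = volV μ := by simp [intV, volV]
    have hvol := (volV_pos hμ).ne'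
    simp only [h2, h4, Pi.one_apply, mul_one, h3, mul_zero, sum_const_zero, ← hI] at h1
    change intV μ f = 0
    rw [h1]
    field_simp
    ring
  have hfU : ∀ j, intV μ (fun x => f x * U j x) = 0 := by
    intro j
    rw [hmul, shiftedForm_eq_zero_of_mem_eigSp hws hμ (hUeig j), show intV μ (U j) = 0 from
      (hUeig j).1]
    simp only [hUon, mul_ite, mul_one, mul_zero, sum_ite_eq', mem_univ, if_true, hk,
      mul_right_comm (h _) (U j _)]
    ring
  have hfperp : f ∈ eigPerp G w μ a :=
    ⟨hfH, fun v hv => intV_mul_eq_zero_of_mem_span hfU (hUspan v hv)⟩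
  have hzero : f = 0 := eq_zero_of_intV_sq_eq_zero hμ (by
    have h1 : ∀ i, intV μ (fun x => U i x * f x) = 0 := fun i => by
      simpa only [mul_comm] using hfU i
    simp only [sq]
    rw [hmul, shiftedForm_eq_of_isMinOn hμ hh hu hmin hfperp, show intV μ f = 0 from hfH]
    simp only [h1, mul_zero, sum_const_zero]
    ring)
  intro x
  have hx := congrFun hzero x
  simp only [hf, Pi.zero_apply] at hx
  linear_combination hx
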